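/- Let a(n) be the number of Dyck paths of semi-length n with no peak whose height lies in {2,5} and no valley whose height lies in {1,4}, and let f = \sum_{n\ge 0} a(n) x^n in the ring of formal power series over the integers. Then (4x^6 - 13x^5 + 24x^4 - 27x^3 + 19x^2 - 7x + 1) f^2 + (4x^5 - 15x^4 + 26x^3 - 26x^2 + 12x - 2) f + (x^4 - 4x^3 + 8x^2 - 5x + 1) = 0. -/

import Mathlib

open Finset PowerSeries

/-- A word over the step alphabet (`true` = U = (1,1), `false` = D = (1,-1)) is a
Dyck path if it has equally many U's and D's and every prefix has at least as
many U's as D's (i.e. the lattice path never goes below the x-axis). -/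
def IsDyck (w : List Bool) : Prop :=
  w.count true = w.count false ∧
    ∀ k, (w.take k).count false ≤ (w.take k).count true
/-- The height (y-coordinate) of the lattice point reached after the first `k` steps. -/
def ht (w : List Bool) (k : ℕ) : ℕ :=
  (w.take k).count true - (w.take k).count false
/-- The word `w` has a peak (an occurrence of the factor `UD`) at position `i`;
the height of this peak is `ht w (i+1)`. -/
def IsPeakAt (w : List Bool) (i : ℕ) : Prop :=
  w[i]? = some true ∧ w[i + 1]? = some false
/-- The word `w` has a valley (an occurrence of the factor `DU`) at position `i`;
the height of this valley is `ht w (i+1)`. -/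
def IsValleyAt (w : List Bool) (i : ℕ) : Prop :=
  w[i]? = some false ∧ w[i + 1]? = some true

/-- The Dyck word over `Bool` encoded by a binary tree through first-return decomposition. -/
def treeWord : BinaryTree Unit → List Bool
  | .nil => []
  | .node _ l r => true :: (treeWord l ++ false :: treeWord r)

/-- `w`, read as a path starting at height `h`, has no peak with height in `P` and no valley
with height in `V`. -/
def Avoids (P V : Set ℕ) (h : ℕ) (w : List Bool) : Prop :=
  (∀ i, IsPeakAt w i →
    h + (w.take (i + 1)).count true - (w.take (i + 1)).count false ∉ P) ∧
  ∀ i, IsValleyAt w i →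
    h + (w.take (i + 1)).count true - (w.take (i + 1)).count false ∉ V

/-- The condition on a binary tree which corresponds to `Avoids P V h` on its word. -/
def TreeAvoids (P V : Set ℕ) : ℕ → BinaryTree Unit → Prop
  | _, .nil => True
  | h, .node _ l r =>
    (TreeAvoids P V (h + 1) l ∧ (l = .nil → h + 1 ∉ P)) ∧
      (TreeAvoids P V h r ∧ (r ≠ .nil → h ∉ V))

theorem avoids_nil (P V : Set ℕ) (h : ℕ) : Avoids P V h [] := by
  simp [Avoids, IsPeakAt, IsValleyAt]

theorem avoids_true_cons (P V : Set ℕ) (h : ℕ) (w : List Bool) :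
    Avoids P V h (true :: w) ↔ (w.head? = some false → h + 1 ∉ P) ∧ Avoids P V (h + 1) w := by
  have e (c d : ℕ) : h + (c + 1) - d = h + 1 + c - d := by omega
  unfold Avoids
  rw [← Nat.and_forall_add_one (p := fun i => IsPeakAt (true :: w) i → _),
    ← Nat.and_forall_add_one (p := fun i => IsValleyAt (true :: w) i → _)]
  simp [IsPeakAt, IsValleyAt, List.head?_eq_getElem?, e, and_assoc]
  exact fun _ _ => Iff.rfl

theorem avoids_false_cons (P V : Set ℕ) (h : ℕ) (w : List Bool) :
    Avoids P V (h + 1) (false :: w) ↔ (w.head? = some true → h ∉ V) ∧ Avoids P V h w := by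
  have e (c d : ℕ) : h + 1 + c - (d + 1) = h + c - d := by omega
  unfold Avoids
  rw [← Nat.and_forall_add_one (p := fun i => IsPeakAt (false :: w) i → _),
    ← Nat.and_forall_add_one (p := fun i => IsValleyAt (false :: w) i → _)]
  simp [IsPeakAt, IsValleyAt, List.head?_eq_getElem?, e, and_left_comm]

theorem avoids_treeWord_append (P V : Set ℕ) (t : BinaryTree Unit) (h : ℕ) (s : List Bool) :
    Avoids P V h (treeWord t ++ s) ↔
      TreeAvoids P V h t ∧ Avoids P V h s ∧ (t ≠ .nil → s.head? = some true → h ∉ V) := by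
  induction t generalizing h s with
  | nil => simp [treeWord, TreeAvoids]
  | node _ l r ihl ihr =>
    have hl : (treeWord l ++ false :: (treeWord r ++ s)).head? = some false ↔ l = .nil := by
      cases l <;> simp [treeWord]
    have hr : (treeWord r ++ s).head? = some true ↔ r ≠ .nil ∨ s.head? = some true := by
      cases r <;> simp [treeWord]
    simp only [treeWord, TreeAvoids, List.cons_append, List.append_assoc, avoids_true_cons, hl,
      ihl, avoids_false_cons, hr, ihr, List.head?_cons]
    simp
    tauto

theorem avoids_treeWord (P V : Set ℕ) (h : ℕ) (t : BinaryTree Unit) :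
    Avoids P V h (treeWord t) ↔ TreeAvoids P V h t := by
  simpa [avoids_nil] using avoids_treeWord_append P V t h []

/-- The letter of a Dyck step: `true` for `U` and `false` for `D`. -/
def DyckStep.toBool (s : DyckStep) : Bool := s = .U

theorem DyckStep.toBool_injective : Function.Injective DyckStep.toBool := by
  intro a b
  cases a <;> cases b <;> simp [toBool]

theorem treeWord_eq_map (t : BinaryTree Unit) :
    treeWord t = (DyckWord.ofTree t).toList.map DyckStep.toBool := by
  induction t with
  | nil => rfl
  | node _ l r ihl ihr =>
    rw [treeWord, ihl, ihr]
    change _ = List.map _ (([DyckStep.U] ++ (DyckWord.ofTree l).toList ++ [DyckStep.D]) ++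
      (DyckWord.ofTree r).toList)
    simp [DyckStep.toBool]

theorem treeWord_injective : Function.Injective treeWord := by
  intro s t hst
  rw [treeWord_eq_map, treeWord_eq_map] at hst
  exact DyckWord.equivTree.symm.injective
    (DyckWord.ext (List.map_injective_iff.2 DyckStep.toBool_injective hst))

theorem count_true_map_toBool (w : List DyckStep) :
    (w.map DyckStep.toBool).count true = w.count .U :=
  List.count_map_of_injective w _ DyckStep.toBool_injective .U

theorem count_false_map_toBool (w : List DyckStep) :
    (w.map DyckStep.toBool).count false = w.count .D :=
  List.count_map_of_injective w _ DyckStep.toBool_injective .D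

theorem exists_treeWord_eq_iff (w : List Bool) : (∃ t, treeWord t = w) ↔ IsDyck w := by
  constructor
  · rintro ⟨t, rfl⟩
    rw [treeWord_eq_map]
    refine ⟨?_, fun k => ?_⟩
    · simpa only [count_true_map_toBool, count_false_map_toBool] using
        (DyckWord.ofTree t).count_U_eq_count_D
    · simpa only [← List.map_take, count_true_map_toBool, count_false_map_toBool] using
        (DyckWord.ofTree t).count_D_le_count_U k
  · intro hw
    obtain ⟨v, rfl⟩ : ∃ v : List DyckStep, v.map DyckStep.toBool = w :=
      List.map_surjective_iff.2 (fun b => by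
        cases b
        · exact ⟨.D, rfl⟩
        · exact ⟨.U, rfl⟩) w
    simp only [IsDyck, ← List.map_take, count_true_map_toBool, count_false_map_toBool] at hw
    refine ⟨DyckWord.toTree ⟨v, hw.1, hw.2⟩, ?_⟩
    rw [treeWord_eq_map, DyckWord.ofTree_toTree]

theorem count_true_treeWord (t : BinaryTree Unit) : (treeWord t).count true = t.numNodes := by
  induction t with
  | nil => rfl
  | node _ l r ihl ihr =>
    simp [treeWord, BinaryTree.numNodes, ihl, ihr]

open Classical in
/-- The generating function, by number of internal nodes, of the binary trees satisfying `p`. -/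
noncomputable def treeSeries (p : BinaryTree Unit → Prop) : ℤ⟦X⟧ :=
  PowerSeries.mk fun n => (#{t ∈ BinaryTree.treesOfNumNodesEq n | p t} : ℤ)

theorem treeSeries_eq_of_node {p q r : BinaryTree Unit → Prop} (h_nil : p .nil)
    (h_node : ∀ a b, p (.node () a b) ↔ q a ∧ r b) :
    treeSeries p = 1 + X * (treeSeries q * treeSeries r) := by
  classical
  ext n
  cases n with
  | zero => simp [treeSeries, h_nil, Finset.filter_singleton]
  | succ n =>
    rw [map_add, coeff_succ_X_mul, coeff_mul, coeff_one, if_neg n.succ_ne_zero, zero_add]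
    simp only [treeSeries, coeff_mk]
    rw [BinaryTree.treesOfNumNodesEq_succ, Finset.filter_biUnion, Finset.card_biUnion]
    · push_cast
      refine Finset.sum_congr rfl fun ij _ => ?_
      rw [Finset.filter_map, Finset.card_map, ← Nat.cast_mul, ← Finset.card_product,
        ← Finset.filter_product]
      congr 2
      exact Finset.filter_congr fun ab _ => h_node ab.1 ab.2
    · intro x _ y _ hxy
      refine Finset.disjoint_left.2 ?_
      simp only [Finset.mem_filter, Finset.mem_map]
      rintro _ ⟨⟨u, hu, rfl⟩, _⟩ ⟨⟨v, hv, huv⟩, _⟩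
      obtain ⟨-, huv⟩ := BinaryTree.node.inj huv
      simp only [Finset.mem_product, BinaryTree.mem_treesOfNumNodesEq] at hu hv
      exact hxy (Prod.ext (by rw [← hu.1, ← hv.1, huv.1]) (by rw [← hu.2, ← hv.2, huv.2]))

theorem treeSeries_and_not_nil {p : BinaryTree Unit → Prop} (h_nil : p .nil) :
    treeSeries (fun t => p t ∧ t ≠ .nil) = treeSeries p - 1 := by
  classical
  ext n
  cases n with
  | zero => simp [treeSeries, h_nil, Finset.filter_singleton]
  | succ n =>
    rw [map_sub, coeff_one, if_neg n.succ_ne_zero, sub_zero]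
    simp only [treeSeries, coeff_mk]
    congr 2
    refine Finset.filter_congr fun t ht => and_iff_left ?_
    rintro rfl
    simp [BinaryTree.mem_treesOfNumNodesEq] at ht

theorem treeSeries_eq_nil : treeSeries (· = .nil) = 1 := by
  rw [treeSeries_eq_of_node (p := (· = .nil)) (q := fun _ => False) (r := fun _ => False) rfl (by simp)]
  have : treeSeries (fun _ => False) = 0 := by
    ext n
    simp [treeSeries]
  simp [this]

/-- The generating function of Dyck paths starting at height `h` which avoid peaks with height
in `P` and valleys with height in `V`. -/
noncomputable def avoidSeries (P V : Set ℕ) (h : ℕ) : ℤ⟦X⟧ := treeSeries (TreeAvoids P V h)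

section Recurrence

variable {P V : Set ℕ} {h : ℕ}

theorem avoidSeries_of_notMem_of_notMem (hP : h + 1 ∉ P) (hV : h ∉ V) :
    avoidSeries P V h = 1 + X * (avoidSeries P V (h + 1) * avoidSeries P V h) :=
  treeSeries_eq_of_node trivial fun a b => by simp [TreeAvoids, hP, hV]

theorem avoidSeries_of_mem_of_mem (hP : h + 1 ∈ P) (hV : h ∈ V) :
    avoidSeries P V h = 1 + X * (avoidSeries P V (h + 1) - 1) := by
  rw [avoidSeries, treeSeries_eq_of_node (q := fun t => TreeAvoids P V (h + 1) t ∧ t ≠ .nil)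
    (r := (· = .nil)) trivial, treeSeries_and_not_nil trivial, treeSeries_eq_nil, mul_one,
    avoidSeries]
  intro a b
  simp only [TreeAvoids, hP, hV, not_true_eq_false, imp_false, not_not]
  refine and_congr_right fun _ => and_iff_right_of_imp ?_
  rintro rfl
  trivial

end Recurrence

theorem treeAvoids_congr {P V : Set ℕ} {h k : ℕ} (hP : ∀ m, h + m + 1 ∈ P ↔ k + m + 1 ∈ P)
    (hV : ∀ m, h + m ∈ V ↔ k + m ∈ V) (t : BinaryTree Unit) :
    TreeAvoids P V h t ↔ TreeAvoids P V k t := by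
  induction t generalizing h k with
  | nil => rfl
  | node _ l r ihl ihr =>
    have h1 := ihl (h := h + 1) (k := k + 1) (fun m => by
      simpa only [add_assoc, add_comm, add_left_comm] using hP (m + 1)) (fun m => by
      simpa only [add_assoc, add_comm, add_left_comm] using hV (m + 1))
    have h2 := hP 0
    have h3 := hV 0
    simp only [add_zero] at h2 h3
    simp only [TreeAvoids, h1, ihr hP hV, h2, h3]

theorem natCard_avoids (P V : Set ℕ) (n : ℕ) :
    (Nat.card {w : List Bool // IsDyck w ∧ w.count true = n ∧ Avoids P V 0 w} : ℤ) =
      coeff n (avoidSeries P V 0) := by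
  classical
  have : {w : List Bool | IsDyck w ∧ w.count true = n ∧ Avoids P V 0 w} =
      Set.image treeWord ({t ∈ BinaryTree.treesOfNumNodesEq n | TreeAvoids P V 0 t} : Finset _) := by
    ext w
    simp only [Set.mem_ofPred_eq, ← exists_treeWord_eq_iff, Set.mem_image, Finset.coe_filter,
      BinaryTree.mem_treesOfNumNodesEq]
    constructor
    · rintro ⟨⟨t, rfl⟩, h1, h2⟩
      exact ⟨t, ⟨count_true_treeWord t ▸ h1, (avoids_treeWord ..).1 h2⟩, rfl⟩
    · rintro ⟨t, ⟨h1, h2⟩, rfl⟩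
      exact ⟨⟨t, rfl⟩, (count_true_treeWord t).trans h1, (avoids_treeWord ..).2 h2⟩
  change (Set.ncard {w : List Bool | IsDyck w ∧ w.count true = n ∧ Avoids P V 0 w} : ℤ) = _
  rw [this, Set.ncard_image_of_injective _ treeWord_injective, Set.ncard_coe_finset, avoidSeries,
    treeSeries, coeff_mk]

/-- If `a n` counts Dyck paths of semi-length `n` with no peak of height in
`{2, 5}` and no valley of height in `{1, 4}`, then `f = ∑ a(n) xⁿ` over `ℤ`
satisfies the stated quadratic equation. -/
theorem statement11 (a : ℕ → ℕ)
    (ha : ∀ n, a n = Nat.card {w : List Bool // IsDyck w ∧ w.count true = n ∧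
      (∀ i, IsPeakAt w i → ht w (i + 1) ∉ ({2, 5} : Set ℕ)) ∧
      (∀ i, IsValleyAt w i → ht w (i + 1) ∉ ({1, 4} : Set ℕ))})
    (f : PowerSeries ℤ) (hf : f = PowerSeries.mk fun n => (a n : ℤ)) :
    (4 * PowerSeries.X ^ 6 - 13 * PowerSeries.X ^ 5 + 24 * PowerSeries.X ^ 4 -
        27 * PowerSeries.X ^ 3 + 19 * PowerSeries.X ^ 2 - 7 * PowerSeries.X + 1) * f ^ 2 +
      (4 * PowerSeries.X ^ 5 - 15 * PowerSeries.X ^ 4 + 26 * PowerSeries.X ^ 3 -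
        26 * PowerSeries.X ^ 2 + 12 * PowerSeries.X - 2) * f +
      (PowerSeries.X ^ 4 - 4 * PowerSeries.X ^ 3 + 8 * PowerSeries.X ^ 2 -
        5 * PowerSeries.X + 1) = 0 := by
  set F := avoidSeries {2, 5} {1, 4} with hF
  have hf0 : f = F 0 := by
    ext n
    rw [hf, coeff_mk, ha, hF, ← natCard_avoids]
    simp [Avoids, ht]
  have h0 : F 0 = 1 + X * (F 1 * F 0) :=
    avoidSeries_of_notMem_of_notMem (by simp) (by simp)
  have h1 : F 1 = 1 + X * (F 2 - 1) := avoidSeries_of_mem_of_mem (by simp) (by simp)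
  have h2 : F 2 = 1 + X * (F 3 * F 2) :=
    avoidSeries_of_notMem_of_notMem (by simp) (by simp)
  have h3 : F 3 = 1 + X * (F 4 * F 3) :=
    avoidSeries_of_notMem_of_notMem (by simp) (by simp)
  have h4 : F 4 = 1 + X * (F 5 - 1) := avoidSeries_of_mem_of_mem (by simp) (by simp)
  have h5 : F 5 = 1 + X * (F 6 * F 5) :=
    avoidSeries_of_notMem_of_notMem (by simp) (by simp)
  have h6 : F 6 = F 5 :=
    congrArg treeSeries (funext fun t => propext (treeAvoids_congr
      (fun m => by simp; omega) (fun m => by simp; omega) t))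
  rw [h6] at h5
  rw [hf0]
  generalize F 0 = f0, F 1 = f1, F 2 = f2, F 3 = f3, F 4 = f4, F 5 = c at *
  obtain ⟨u, hu⟩ : ∃ u, u = 1 - X * f4 := ⟨_, rfl⟩
  have e3 : f3 * u = 1 := by linear_combination h3 + f3 * hu
  have e2 : f2 * (u - X) = u := by linear_combination u * h2 + X * f2 * e3
  have e1 : (1 - X * f1) * (u - X) = (1 - X + X ^ 2) * (u - X) - X ^ 2 * u := by
    linear_combination (-X * (u - X)) * h1 - X ^ 2 * e2
  have e0 : f0 * ((1 - X + X ^ 2) * (u - X) - X ^ 2 * u) = u - X := by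
    linear_combination (u - X) * h0 - f0 * e1
  have ec : u = 1 - X + X ^ 2 - X ^ 2 * c := by linear_combination hu - X * h4
  have hq : (X ^ 2 * c) ^ 2 - X * (X ^ 2 * c) + X ^ 3 = 0 := by
    linear_combination -X ^ 3 * h5
  have hα : (f0 * (1 - X) - 1) * u = X * (f0 * (1 - X + X ^ 2) - 1) := by
    linear_combination e0
  subst ec
  linear_combination (f0 * (1 - X) - 1) ^ 2 * hq +
    (2 * (f0 * (1 - X) - 1) * (1 - X + X ^ 2) - X * (f0 * (1 - X + X ^ 2) - 1) -
      (f0 * (1 - X) - 1) * (1 - X + X ^ 2 - X ^ 2 * c) - X * (f0 * (1 - X) - 1)) * hα
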